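/- Let α ∈ (0,1) and let f : [0,1] → ℝ be differentiable with f(0) = f(1) = 0 and with f' Lipschitz on [0,1]. Then for every x ∈ (0,1): the limit defining D_{α+1}(f)(x) exists if and only if the limit defining D_α(f')(x) exists, and in that case D_{α+1}(f)(x) = 2 · D_α(f')(x). -/

import Mathlib

open MeasureTheory Filter Asymptotics

/-- The `n`-th Fourier coefficient of `φ_β(θ) = (1-e^{iθ})^β (1+e^{-iθ})^β`
(principal branch complex powers). -/
noncomputable def phiHat (β : ℝ) (n : ℤ) : ℂ :=
  (1 / (2 * (Real.pi : ℂ))) * ∫ θ in (-Real.pi)..Real.pi,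
    (1 - Complex.exp ((θ : ℂ) * Complex.I)) ^ (β : ℂ) *
      (1 + Complex.exp (-(θ : ℂ) * Complex.I)) ^ (β : ℂ) *
      Complex.exp (-(n : ℂ) * (θ : ℂ) * Complex.I)

/-- The discretization vector `X_{N,l}`: `g(l/N)` for `0 < l < N`, and `0` at the endpoints. -/
noncomputable def Xvec (g : ℝ → ℝ) (N l : ℕ) : ℝ :=
  if l = 0 ∨ l = N then 0 else g ((l : ℝ) / (N : ℝ))

/-- `g` is `β`-differentiable at `x` with derivative `L`:
`lim_N N^β Σ_{l=0}^N φ̂_β(⌊Nx⌋ - l) X_{N,l} = L`. -/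
def HasDAt (β : ℝ) (g : ℝ → ℝ) (x : ℝ) (L : ℂ) : Prop :=
  Tendsto
    (fun N : ℕ => (((N : ℝ) ^ β : ℝ) : ℂ) *
      ∑ l ∈ Finset.range (N + 1), phiHat β (⌊(N : ℝ) * x⌋ - (l : ℤ)) * ((Xvec g N l : ℝ) : ℂ))
    atTop (nhds L)

/-- The symbol `φ_β` whose Fourier coefficients are `phiHat β`. -/
noncomputable def phiSymbol (β : ℝ) (θ : ℝ) : ℂ :=
  (1 - Complex.exp ((θ : ℂ) * Complex.I)) ^ (β : ℂ) *
    (1 + Complex.exp (-(θ : ℂ) * Complex.I)) ^ (β : ℂ)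

lemma one_sub_exp_re (θ : ℝ) :
    (1 - Complex.exp ((θ : ℂ) * Complex.I)).re = 1 - Real.cos θ := by
  simp [Complex.exp_ofReal_mul_I_re]

lemma one_add_exp_neg_re (θ : ℝ) :
    (1 + Complex.exp (-(θ : ℂ) * Complex.I)).re = 1 + Real.cos θ := by
  have := Complex.exp_ofReal_mul_I_re (-θ)
  push_cast at this
  rw [Complex.add_re, this, Complex.one_re, Real.cos_neg]

lemma continuous_phiSymbol {β : ℝ} (hβ : 0 < β) : Continuous (phiSymbol β) := by
  have hpow {g : ℝ → ℂ} (hg : Continuous g) (hre : ∀ θ, 0 ≤ (g θ).re) :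
      Continuous fun θ => g θ ^ (β : ℂ) := by
    refine continuous_iff_continuousAt.2 fun θ => ?_
    exact ContinuousAt.comp (f := g) (g := fun z : ℂ => z ^ (β : ℂ))
      (Complex.continuousAt_cpow_const_of_re_pos (Or.inl (hre θ)) (by simpa using hβ))
      hg.continuousAt
  refine (hpow (by fun_prop) fun θ => ?_).mul (hpow (by fun_prop) fun θ => ?_)
  · rw [one_sub_exp_re]
    linarith [Real.cos_le_one θ]
  · rw [one_add_exp_neg_re]
    linarith [Real.neg_one_le_cos θ]

lemma phiSymbol_add_one {β : ℝ} (hβ : 0 < β) (θ : ℝ) :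
    phiSymbol (β + 1) θ = phiSymbol β θ *
      (Complex.exp (-(θ : ℂ) * Complex.I) - Complex.exp ((θ : ℂ) * Complex.I)) := by
  have hpow (z : ℂ) : z ^ ((β + 1 : ℝ) : ℂ) = z ^ (β : ℂ) * z := by
    rcases eq_or_ne z 0 with rfl | hz
    · rw [Complex.zero_cpow, mul_zero]
      exact_mod_cast (by linarith : β + 1 ≠ 0)
    · push_cast
      rw [Complex.cpow_add _ _ hz, Complex.cpow_one]
  have hexp : Complex.exp ((θ : ℂ) * Complex.I) * Complex.exp (-(θ : ℂ) * Complex.I) = 1 := by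
    rw [← Complex.exp_add]
    simp
  simp only [phiSymbol, hpow]
  linear_combination -(1 - Complex.exp ((θ : ℂ) * Complex.I)) ^ (β : ℂ) *
    (1 + Complex.exp (-(θ : ℂ) * Complex.I)) ^ (β : ℂ) * hexp

lemma phiHat_eq (β : ℝ) (n : ℤ) :
    phiHat β n = (1 / (2 * (Real.pi : ℂ))) * ∫ θ in (-Real.pi)..Real.pi,
      phiSymbol β θ * Complex.exp (-(n : ℂ) * (θ : ℂ) * Complex.I) := rfl

lemma intervalIntegrable_phiSymbol_mul_exp {β : ℝ} (hβ : 0 < β) (c : ℂ) (a b : ℝ) :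
    IntervalIntegrable (fun θ : ℝ => phiSymbol β θ * Complex.exp (-c * (θ : ℂ) * Complex.I))
      volume a b :=
  ((continuous_phiSymbol hβ).mul (by fun_prop)).intervalIntegrable a b

lemma exp_shift_succ (n : ℤ) (θ : ℝ) :
    Complex.exp (-((n + 1 : ℤ) : ℂ) * (θ : ℂ) * Complex.I) =
      Complex.exp (-(θ : ℂ) * Complex.I) * Complex.exp (-(n : ℂ) * (θ : ℂ) * Complex.I) := by
  rw [← Complex.exp_add]
  congr 1
  push_cast
  ring

lemma exp_shift_pred (n : ℤ) (θ : ℝ) :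
    Complex.exp (-((n - 1 : ℤ) : ℂ) * (θ : ℂ) * Complex.I) =
      Complex.exp ((θ : ℂ) * Complex.I) * Complex.exp (-(n : ℂ) * (θ : ℂ) * Complex.I) := by
  rw [← Complex.exp_add]
  congr 1
  push_cast
  ring

lemma phiHat_add_one {β : ℝ} (hβ : 0 < β) (n : ℤ) :
    phiHat (β + 1) n = phiHat β (n + 1) - phiHat β (n - 1) := by
  rw [phiHat_eq, phiHat_eq, phiHat_eq, ← mul_sub, ← intervalIntegral.integral_sub
    (intervalIntegrable_phiSymbol_mul_exp hβ _ _ _)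
    (intervalIntegrable_phiSymbol_mul_exp hβ _ _ _)]
  congr 2
  ext θ
  rw [phiSymbol_add_one hβ, exp_shift_succ, exp_shift_pred]
  ring

lemma hasDerivAt_phiSymbol_add_one (β : ℝ) {θ : ℝ} (hθ : θ ∈ Set.Ioo (-Real.pi) Real.pi)
    (hθ0 : θ ≠ 0) :
    HasDerivAt (phiSymbol (β + 1)) ((β + 1) * phiSymbol β θ *
      (-Complex.I * (Complex.exp (-(θ : ℂ) * Complex.I) + Complex.exp ((θ : ℂ) * Complex.I)))) θ := by
  have hcos1 : Real.cos θ < 1 := by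
    refine lt_of_le_of_ne (Real.cos_le_one θ) fun h => hθ0 ?_
    exact (Real.cos_eq_one_iff_of_lt_of_lt (by linarith [hθ.1, Real.pi_pos])
      (by linarith [hθ.2, Real.pi_pos])).1 h
  have hcos2 : -1 < Real.cos θ := by
    rw [← Real.cos_abs, ← Real.cos_pi]
    exact Real.cos_lt_cos_of_nonneg_of_le_pi (abs_nonneg θ) le_rfl (abs_lt.2 hθ)
  have hs1 : 1 - Complex.exp ((θ : ℂ) * Complex.I) ∈ Complex.slitPlane :=
    Or.inl (by rw [one_sub_exp_re]; linarith)
  have hs2 : 1 + Complex.exp (-(θ : ℂ) * Complex.I) ∈ Complex.slitPlane :=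
    Or.inl (by rw [one_add_exp_neg_re]; linarith)
  have hof : HasDerivAt (fun t : ℝ => (t : ℂ)) 1 θ := Complex.ofRealCLM.hasDerivAt
  have hd1 : HasDerivAt (fun t : ℝ => 1 - Complex.exp ((t : ℂ) * Complex.I))
      (-(Complex.exp ((θ : ℂ) * Complex.I) * (1 * Complex.I))) θ :=
    ((hof.mul_const Complex.I).cexp).const_sub 1
  have hd2 : HasDerivAt (fun t : ℝ => 1 + Complex.exp (-(t : ℂ) * Complex.I))
      (Complex.exp (-(θ : ℂ) * Complex.I) * (-1 * Complex.I)) θ :=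
    ((hof.neg.mul_const Complex.I).cexp).const_add 1
  have hp {z : ℂ} (hz : z ∈ Complex.slitPlane) :
      HasDerivAt (fun w : ℂ => w ^ ((β + 1 : ℝ) : ℂ)) (((β + 1 : ℝ) : ℂ) * z ^ (β : ℂ)) z := by
    have h := (hasDerivAt_id z).cpow_const (c := ((β + 1 : ℝ) : ℂ)) hz
    simpa using h
  have hpow {z : ℂ} (hz : z ∈ Complex.slitPlane) :
      z ^ ((β + 1 : ℝ) : ℂ) = z ^ (β : ℂ) * z := by
    push_cast
    rw [Complex.cpow_add _ _ (Complex.slitPlane_ne_zero hz), Complex.cpow_one]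
  have hprod := ((hp hs1).comp θ hd1).mul ((hp hs2).comp θ hd2)
  refine hprod.congr_deriv ?_
  simp only [Function.comp_apply]
  rw [hpow hs1, hpow hs2]
  simp only [phiSymbol]
  push_cast
  ring

/-- The two-step recurrence for the Fourier coefficients, obtained by integrating
the derivative of `φ_{β+1}(θ) e^{-inθ}` over a period. -/
lemma phiHat_recurrence {β : ℝ} (hβ : 0 < β) (n : ℤ) :
    ((n : ℂ) + 1 + β) * phiHat β (n + 1) = ((n : ℂ) - 1 - β) * phiHat β (n - 1) := by
  set e : ℝ → ℂ := fun θ => Complex.exp (-(n : ℂ) * (θ : ℂ) * Complex.I) with he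
  set ep : ℝ → ℂ := fun θ => Complex.exp (-((n + 1 : ℤ) : ℂ) * (θ : ℂ) * Complex.I) with hep
  set em : ℝ → ℂ := fun θ => Complex.exp (-((n - 1 : ℤ) : ℂ) * (θ : ℂ) * Complex.I) with hem
  have hderiv : ∀ θ ∈ Set.Ioo (-Real.pi) Real.pi \ {0},
      HasDerivAt (fun θ => phiSymbol (β + 1) θ * e θ)
        ((-Complex.I * (n + 1 + β)) * (phiSymbol β θ * ep θ) -
          (-Complex.I * (n - 1 - β)) * (phiSymbol β θ * em θ)) θ := by
    rintro θ ⟨hθ, hθ0⟩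
    have hof : HasDerivAt (fun t : ℝ => (t : ℂ)) 1 θ := Complex.ofRealCLM.hasDerivAt
    have hde : HasDerivAt e (e θ * (-(n : ℂ) * 1 * Complex.I)) θ :=
      ((hof.const_mul (-(n : ℂ))).mul_const Complex.I).cexp
    refine ((hasDerivAt_phiSymbol_add_one β hθ hθ0).mul hde).congr_deriv ?_
    rw [phiSymbol_add_one hβ]
    simp only [he, hep, hem, exp_shift_succ, exp_shift_pred]
    ring
  have hip : IntervalIntegrable (fun θ => phiSymbol β θ * ep θ) volume (-Real.pi) Real.pi :=
    intervalIntegrable_phiSymbol_mul_exp hβ _ _ _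
  have him : IntervalIntegrable (fun θ => phiSymbol β θ * em θ) volume (-Real.pi) Real.pi :=
    intervalIntegrable_phiSymbol_mul_exp hβ _ _ _
  have hcont : Continuous fun θ => phiSymbol (β + 1) θ * e θ :=
    (continuous_phiSymbol (by linarith)).mul (by fun_prop)
  have hle : -Real.pi ≤ Real.pi := by linarith [Real.pi_pos]
  have hint := integral_eq_of_hasDerivAt_off_countable_of_le
    (fun θ => phiSymbol (β + 1) θ * e θ) _ hle (Set.countable_singleton 0) hcont.continuousOn
    hderiv ((hip.const_mul _).sub (him.const_mul _))
  have hz1 : phiSymbol (β + 1) Real.pi = 0 := by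
    rw [phiSymbol_add_one hβ, neg_mul, Complex.exp_neg, Complex.exp_pi_mul_I]
    norm_num
  have hz2 : phiSymbol (β + 1) (-Real.pi) = 0 := by
    rw [phiSymbol_add_one hβ]
    push_cast
    rw [neg_neg, neg_mul, Complex.exp_neg, Complex.exp_pi_mul_I]
    norm_num
  rw [intervalIntegral.integral_sub (hip.const_mul _) (him.const_mul _),
    intervalIntegral.integral_const_mul, intervalIntegral.integral_const_mul] at hint
  simp only [hz1, hz2, zero_mul, sub_zero] at hint
  rw [phiHat_eq, phiHat_eq]
  linear_combination (1 / (2 * (Real.pi : ℂ))) * Complex.I * hint +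
    (1 / (2 * (Real.pi : ℂ))) * (((n : ℂ) + 1 + β) *
      (∫ θ in (-Real.pi)..Real.pi, phiSymbol β θ * ep θ) -
      ((n : ℂ) - 1 - β) * (∫ θ in (-Real.pi)..Real.pi, phiSymbol β θ * em θ)) * Complex.I_mul_I

/-- A nonnegative sequence satisfying the two-step recurrence is summable and `O(1/n)`:
`n c_n + (n+1) c_{n+1}` decreases by `α (c_n + c_{n+2})` at each step. -/
lemma summable_of_two_step_recurrence {α : ℝ} (hα : 0 < α) {c : ℕ → ℝ} (hc : ∀ n, 0 ≤ c n)
    (hrec : ∀ n : ℕ, ((n : ℝ) + 3 + α) * c (n + 3) = ((n : ℝ) + 1 - α) * c (n + 1)) :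
    Summable c ∧ ∃ C, ∀ n : ℕ, (n : ℝ) * c n ≤ C := by
  have key (n : ℕ) : α * ∑ i ∈ Finset.range n, c (i + 1) +
      (((n : ℝ) + 1) * c (n + 1) + ((n : ℝ) + 2) * c (n + 2)) ≤ c 1 + 2 * c 2 := by
    induction n with
    | zero => simp
    | succ n ih =>
      rw [Finset.sum_range_succ]
      push_cast
      have h := hrec n
      have h3 := mul_nonneg hα.le (hc (n + 3))
      rw [show n + 1 + 1 = n + 2 from rfl, show n + 1 + 2 = n + 3 from rfl]
      linarith
  refine ⟨(summable_nat_add_iff 1).1 (summable_of_sum_range_le (c := (c 1 + 2 * c 2) / α)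
    (fun n => hc (n + 1)) fun n => ?_), c 1 + 2 * c 2, fun n => ?_⟩
  · rw [le_div_iff₀ hα]
    have h1 : 0 ≤ ((n : ℝ) + 1) * c (n + 1) := mul_nonneg (by positivity) (hc _)
    have h2 : 0 ≤ ((n : ℝ) + 2) * c (n + 2) := mul_nonneg (by positivity) (hc _)
    linarith [key n]
  · rcases n with _ | n
    · simpa using add_nonneg (hc 1) (mul_nonneg zero_le_two (hc 2))
    · have h1 : 0 ≤ α * ∑ i ∈ Finset.range n, c (i + 1) :=
        mul_nonneg hα.le (Finset.sum_nonneg fun i _ => hc _)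
      have h2 : 0 ≤ ((n : ℝ) + 2) * c (n + 2) := mul_nonneg (by positivity) (hc _)
      push_cast
      linarith [key n]

lemma norm_phiHat_recurrence {α : ℝ} (hα : α ∈ Set.Ioo (0 : ℝ) 1) (n : ℕ) :
    ((n : ℝ) + 3 + α) * ‖phiHat α ((n + 3 : ℕ) : ℤ)‖ =
      ((n : ℝ) + 1 - α) * ‖phiHat α ((n + 1 : ℕ) : ℤ)‖ := by
  have h := congrArg norm (phiHat_recurrence hα.1 ((n : ℤ) + 2))
  have hn : (0 : ℝ) ≤ n := n.cast_nonneg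
  have e1 : (((n : ℤ) + 2 : ℤ) : ℂ) + 1 + α = (((n : ℝ) + 3 + α : ℝ) : ℂ) := by
    push_cast
    ring
  have e2 : (((n : ℤ) + 2 : ℤ) : ℂ) - 1 - α = (((n : ℝ) + 1 - α : ℝ) : ℂ) := by
    push_cast
    ring
  rw [norm_mul, norm_mul, e1, e2, Complex.norm_of_nonneg (by linarith [hα.1]),
    Complex.norm_of_nonneg (by linarith [hα.2])] at h
  convert h using 4 <;> (push_cast; ring)

lemma norm_phiHat_neg_recurrence {α : ℝ} (hα : α ∈ Set.Ioo (0 : ℝ) 1) (n : ℕ) :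
    ((n : ℝ) + 3 + α) * ‖phiHat α (-((n + 3 : ℕ) : ℤ))‖ =
      ((n : ℝ) + 1 - α) * ‖phiHat α (-((n + 1 : ℕ) : ℤ))‖ := by
  have h := congrArg norm (phiHat_recurrence hα.1 (-((n : ℤ) + 2)))
  have hn : (0 : ℝ) ≤ n := n.cast_nonneg
  have e1 : ((-((n : ℤ) + 2) : ℤ) : ℂ) + 1 + α = -(((n : ℝ) + 1 - α : ℝ) : ℂ) := by
    push_cast
    ring
  have e2 : ((-((n : ℤ) + 2) : ℤ) : ℂ) - 1 - α = -(((n : ℝ) + 3 + α : ℝ) : ℂ) := by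
    push_cast
    ring
  rw [norm_mul, norm_mul, e1, e2, norm_neg, norm_neg, Complex.norm_of_nonneg (by linarith [hα.2]),
    Complex.norm_of_nonneg (by linarith [hα.1])] at h
  convert h.symm using 4 <;> (push_cast; ring)

lemma summable_norm_phiHat {α : ℝ} (hα : α ∈ Set.Ioo (0 : ℝ) 1) :
    Summable fun n : ℤ => ‖phiHat α n‖ :=
  Summable.of_nat_of_neg
    (summable_of_two_step_recurrence (c := fun n => ‖phiHat α (n : ℤ)‖) hα.1
      (fun _ => norm_nonneg _) (norm_phiHat_recurrence hα)).1
    (summable_of_two_step_recurrence (c := fun n => ‖phiHat α (-(n : ℤ))‖) hα.1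
      (fun _ => norm_nonneg _) (norm_phiHat_neg_recurrence hα)).1

lemma exists_norm_phiHat_bound {α : ℝ} (hα : α ∈ Set.Ioo (0 : ℝ) 1) :
    ∃ A, ∀ n : ℤ, (|(n : ℝ)| + 1) * ‖phiHat α n‖ ≤ A := by
  obtain ⟨C₁, h₁⟩ := (summable_of_two_step_recurrence (c := fun n => ‖phiHat α (n : ℤ)‖) hα.1
      (fun _ => norm_nonneg _) (norm_phiHat_recurrence hα)).2
  obtain ⟨C₂, h₂⟩ := (summable_of_two_step_recurrence (c := fun n => ‖phiHat α (-(n : ℤ))‖) hα.1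
      (fun _ => norm_nonneg _) (norm_phiHat_neg_recurrence hα)).2
  refine ⟨max C₁ C₂ + ∑' m, ‖phiHat α m‖, fun n => ?_⟩
  have hS : ‖phiHat α n‖ ≤ ∑' m, ‖phiHat α m‖ :=
    (summable_norm_phiHat hα).le_tsum n fun _ _ => norm_nonneg _
  have hn : |(n : ℝ)| * ‖phiHat α n‖ ≤ max C₁ C₂ := by
    obtain ⟨m, rfl | rfl⟩ := n.eq_nat_or_neg
    · refine le_trans ?_ ((h₁ m).trans (le_max_left _ _))
      simp
    · refine le_trans ?_ ((h₂ m).trans (le_max_right _ _))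
      simp
  linarith

/-- Summation by parts for a central difference against a sequence vanishing at both ends. -/
lemma sum_central_difference (b : ℤ → ℂ) (X : ℕ → ℂ) (M : ℕ) (h0 : X 0 = 0) (h1 : X (M + 1) = 0) :
    ∑ l ∈ Finset.range (M + 2), (b ((l : ℤ) - 1) - b ((l : ℤ) + 1)) * X l =
      b 0 * X 1 - b ((M : ℤ) + 1) * X M +
        ∑ l ∈ Finset.range M, b ((l : ℤ) + 1) * (X (l + 2) - X l) := by
  have hA : ∑ l ∈ Finset.range (M + 2), b ((l : ℤ) - 1) * X l =
      b 0 * X 1 + ∑ l ∈ Finset.range M, b ((l : ℤ) + 1) * X (l + 2) := by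
    rw [Finset.sum_range_succ', Finset.sum_range_succ', h0, mul_zero, add_zero, add_comm]
    congr 1
    simp
  have hB : ∑ l ∈ Finset.range (M + 2), b ((l : ℤ) + 1) * X l =
      b ((M : ℤ) + 1) * X M + ∑ l ∈ Finset.range M, b ((l : ℤ) + 1) * X l := by
    rw [Finset.sum_range_succ, Finset.sum_range_succ, h1]
    ring
  simp only [sub_mul, mul_sub, Finset.sum_sub_distrib, hA, hB]
  ring

lemma norm_sub_sub_deriv_le {f : ℝ → ℝ} (hdiff : Differentiable ℝ f) {K : NNReal}
    (hlip : LipschitzOnWith K (deriv f) (Set.Icc (0 : ℝ) 1)) {y z : ℝ}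
    (hy : y ∈ Set.Icc (0 : ℝ) 1) (hz : z ∈ Set.Icc (0 : ℝ) 1) :
    ‖f z - f y - (z - y) * deriv f y‖ ≤ K * |z - y| ^ 2 := by
  have hsub : Set.uIcc y z ⊆ Set.Icc 0 1 := Set.uIcc_subset_Icc hy hz
  have hderiv (t : ℝ) : HasDerivAt (fun t => f t - t * deriv f y) (deriv f t - 1 * deriv f y) t :=
    (hdiff t).hasDerivAt.sub ((hasDerivAt_id t).mul_const _)
  have hbound : ∀ t ∈ Set.uIcc y z, ‖deriv f t - 1 * deriv f y‖ ≤ K * |z - y| := by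
    intro t ht
    rw [one_mul]
    refine (hlip.norm_sub_le (hsub ht) hy).trans ?_
    gcongr
    exact Set.abs_sub_left_of_mem_uIcc ht
  have h := (convex_uIcc y z).norm_image_sub_le_of_norm_hasDerivWithin_le
    (fun t _ => (hderiv t).hasDerivWithinAt) hbound Set.left_mem_uIcc Set.right_mem_uIcc
  rw [Real.norm_eq_abs (z - y)] at h
  calc ‖f z - f y - (z - y) * deriv f y‖ = ‖f z - z * deriv f y - (f y - y * deriv f y)‖ := by
        congr 1
        ring
    _ ≤ K * |z - y| * |z - y| := h
    _ = K * |z - y| ^ 2 := by ring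

lemma Xvec_eq {f : ℝ → ℝ} (h0 : f 0 = 0) (h1 : f 1 = 0) {N : ℕ} (hN : N ≠ 0) (l : ℕ) :
    Xvec f N l = f ((l : ℝ) / N) := by
  unfold Xvec
  split_ifs with h
  · rcases h with rfl | rfl
    · simp [h0]
    · rw [div_self (by exact_mod_cast hN), h1]
  · rfl

/-- The sums defining `D_{α+1}(f)(x)` and `2 D_α(f')(x)` differ by `O(N^{α-1})`. -/
lemma exists_norm_sum_sub_le {α : ℝ} (hα : α ∈ Set.Ioo (0 : ℝ) 1) {f : ℝ → ℝ}
    (hdiff : Differentiable ℝ f) (h0 : f 0 = 0) (h1 : f 1 = 0) {K : NNReal}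
    (hlip : LipschitzOnWith K (deriv f) (Set.Icc (0 : ℝ) 1))
    {x : ℝ} (hx : x ∈ Set.Ioo (0 : ℝ) 1) :
    ∃ C : ℝ, ∀ N : ℕ, N ≠ 0 →
      ‖(((N : ℝ) ^ (α + 1) : ℝ) : ℂ) * ∑ l ∈ Finset.range (N + 1),
          phiHat (α + 1) (⌊(N : ℝ) * x⌋ - (l : ℤ)) * ((Xvec f N l : ℝ) : ℂ) -
        2 * ((((N : ℝ) ^ α : ℝ) : ℂ) * ∑ l ∈ Finset.range (N + 1),
          phiHat α (⌊(N : ℝ) * x⌋ - (l : ℤ)) * ((Xvec (deriv f) N l : ℝ) : ℂ))‖ ≤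
        C * (N : ℝ) ^ (α - 1) := by
  obtain ⟨A, hA⟩ := exists_norm_phiHat_bound hα
  have hS := summable_norm_phiHat hα
  set S := ∑' n, ‖phiHat α n‖
  have hx0 := hx.1
  have hx1 : 0 < 1 - x := by linarith [hx.2]
  have hA0 : 0 ≤ A := le_trans (by positivity) (hA 0)
  set B₀ : ℝ := |deriv f 0| + K
  set B₁ : ℝ := |deriv f 1| + K
  refine ⟨A / x * B₀ + A / (1 - x) * B₁ + S * (2 * K), fun N hN => ?_⟩
  obtain ⟨M, hNM⟩ : ∃ M, N = M + 1 := Nat.exists_eq_succ_of_ne_zero hN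
  set k : ℤ := ⌊(N : ℝ) * x⌋
  have hNpos : (0 : ℝ) < N := by positivity
  have hN1 : (1 : ℝ) ≤ N := by simp [hNM]
  have hNcast : (N : ℝ) = M + 1 := by simp [hNM]
  have hinv : (1 : ℝ) / N ≤ 1 := (div_le_one hNpos).2 hN1
  have hmem {l : ℕ} (hl : l ≤ N) : (l : ℝ) / N ∈ Set.Icc (0 : ℝ) 1 :=
    ⟨by positivity, (div_le_one hNpos).2 (by exact_mod_cast hl)⟩
  -- the discretised sums, rearranged
  have hsum1 : ∑ l ∈ Finset.range (N + 1),
      phiHat (α + 1) (k - (l : ℤ)) * ((Xvec f N l : ℝ) : ℂ) =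
      phiHat α k * (f (1 / N) : ℂ) - phiHat α (k - N) * (f ((M : ℝ) / N) : ℂ) +
        ∑ l ∈ Finset.range M, phiHat α (k - ((l : ℤ) + 1)) *
          ((f (((l + 2 : ℕ) : ℝ) / N) : ℂ) - (f ((l : ℝ) / N) : ℂ)) := by
    have h := sum_central_difference (fun m => phiHat α (k - m)) (fun l => ((Xvec f N l : ℝ) : ℂ)) M
      (by simp [Xvec]) (by simp [Xvec, hNM])
    simp only [Xvec_eq h0 h1 hN] at h ⊢
    rw [sub_zero, Nat.cast_one] at h
    rw [show N + 1 = M + 2 by omega, show (N : ℤ) = (M : ℤ) + 1 by simp [hNM], ← h]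
    refine Finset.sum_congr rfl fun l _ => ?_
    rw [phiHat_add_one hα.1, sub_sub_eq_add_sub, sub_sub, add_sub_right_comm]
  have hsum2 : ∑ l ∈ Finset.range (N + 1),
      phiHat α (k - (l : ℤ)) * ((Xvec (deriv f) N l : ℝ) : ℂ) =
      ∑ l ∈ Finset.range M, phiHat α (k - ((l : ℤ) + 1)) *
        ((deriv f (((l + 1 : ℕ) : ℝ) / N) : ℝ) : ℂ) := by
    rw [Finset.sum_range_succ, show Finset.range N = Finset.range (M + 1) by rw [hNM],
      Finset.sum_range_succ']
    simp only [Xvec, true_or, or_true, if_true, Complex.ofReal_zero, mul_zero, add_zero]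
    refine Finset.sum_congr rfl fun l hl => ?_
    rw [if_neg (by have := Finset.mem_range.1 hl; omega)]
    push_cast
    rfl
  have hpow1 : (N : ℝ) ^ (α + 1) = (N : ℝ) ^ (α - 1) * N ^ 2 := by
    rw [← Real.rpow_natCast, ← Real.rpow_add hNpos]
    congr 1
    push_cast
    ring
  have hpow2 : (N : ℝ) ^ α = (N : ℝ) ^ (α - 1) * N := by
    rw [← Real.rpow_add_one hNpos.ne']
    congr 1
    ring
  have hNC : (N : ℂ) ≠ 0 := by exact_mod_cast hN
  set T : ℂ := ∑ l ∈ Finset.range M, phiHat α (k - ((l : ℤ) + 1)) *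
    ((f (((l + 2 : ℕ) : ℝ) / N) - f ((l : ℝ) / N) -
      2 / N * deriv f (((l + 1 : ℕ) : ℝ) / N) : ℝ) : ℂ) with hT
  have hdecomp : (((N : ℝ) ^ (α + 1) : ℝ) : ℂ) * ∑ l ∈ Finset.range (N + 1),
          phiHat (α + 1) (k - (l : ℤ)) * ((Xvec f N l : ℝ) : ℂ) -
        2 * ((((N : ℝ) ^ α : ℝ) : ℂ) * ∑ l ∈ Finset.range (N + 1),
          phiHat α (k - (l : ℤ)) * ((Xvec (deriv f) N l : ℝ) : ℂ)) =
      (((N : ℝ) ^ (α - 1) : ℝ) : ℂ) * (((N : ℝ) : ℂ) ^ 2 *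
        (phiHat α k * (f (1 / N) : ℂ) - phiHat α (k - N) * (f ((M : ℝ) / N) : ℂ) + T)) := by
    have hT' : T = ∑ l ∈ Finset.range M, phiHat α (k - ((l : ℤ) + 1)) *
          ((f (((l + 2 : ℕ) : ℝ) / N) : ℂ) - (f ((l : ℝ) / N) : ℂ)) -
        2 / N * ∑ l ∈ Finset.range M, phiHat α (k - ((l : ℤ) + 1)) *
          ((deriv f (((l + 1 : ℕ) : ℝ) / N) : ℝ) : ℂ) := by
      rw [hT, Finset.mul_sum, ← Finset.sum_sub_distrib]
      refine Finset.sum_congr rfl fun l _ => ?_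
      push_cast
      ring
    rw [hsum1, hsum2, hT', hpow1, hpow2]
    push_cast
    field_simp
    ring
  -- the boundary terms
  have hb0 : ‖phiHat α k‖ * N ≤ A / x := by
    rw [le_div_iff₀ hx0]
    have h := hA k
    have hlt : (N : ℝ) * x ≤ |(k : ℝ)| + 1 :=
      (Int.lt_floor_add_one _).le.trans (by gcongr; exact le_abs_self _)
    nlinarith [mul_le_mul_of_nonneg_right hlt (norm_nonneg (phiHat α k))]
  have hb1 : ‖phiHat α (k - N)‖ * N ≤ A / (1 - x) := by
    rw [le_div_iff₀ hx1]
    have h := hA (k - N)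
    have hlt : (N : ℝ) * (1 - x) ≤ |((k - N : ℤ) : ℝ)| + 1 := by
      have h1 : (k : ℝ) ≤ N * x := Int.floor_le _
      have h2 := neg_abs_le ((k - N : ℤ) : ℝ)
      push_cast at h2 ⊢
      linarith
    nlinarith [mul_le_mul_of_nonneg_right hlt (norm_nonneg (phiHat α (k - N)))]
  have hf0 : ‖(f (1 / N) : ℂ)‖ * N ≤ B₀ := by
    have h := norm_sub_sub_deriv_le hdiff hlip (y := 0) (z := 1 / N) (by simp)
      ⟨by positivity, hinv⟩
    rw [h0, sub_zero, sub_zero, abs_of_pos (by positivity), Real.norm_eq_abs] at h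
    have h2 : |f (1 / N)| ≤ |1 / N * deriv f 0| + K * (1 / (N : ℝ)) ^ 2 := by
      have := abs_sub_abs_le_abs_sub (f (1 / N)) (1 / N * deriv f 0)
      linarith
    rw [abs_mul, abs_of_pos (by positivity : (0 : ℝ) < 1 / N)] at h2
    rw [Complex.norm_real, Real.norm_eq_abs]
    calc |f (1 / N)| * N ≤ (1 / N * |deriv f 0| + K * (1 / (N : ℝ)) ^ 2) * N := by gcongr
      _ = |deriv f 0| + K * (1 / N) := by field_simp
      _ ≤ |deriv f 0| + K * 1 := by gcongr
      _ = B₀ := by rw [mul_one]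
  have hf1 : ‖(f ((M : ℝ) / N) : ℂ)‖ * N ≤ B₁ := by
    have h := norm_sub_sub_deriv_le hdiff hlip (y := 1) (z := (M : ℝ) / N) (by simp)
      (hmem (by omega))
    have e : (M : ℝ) / N - 1 = -(1 / N) := by
      field_simp
      linarith
    rw [h1, sub_zero, e, abs_neg, abs_of_pos (by positivity), Real.norm_eq_abs] at h
    have h2 : |f (M / N)| ≤ |-(1 / N) * deriv f 1| + K * (1 / (N : ℝ)) ^ 2 := by
      have := abs_sub_abs_le_abs_sub (f (M / N)) (-(1 / N) * deriv f 1)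
      linarith
    rw [abs_mul, abs_neg, abs_of_pos (by positivity : (0 : ℝ) < 1 / N)] at h2
    rw [Complex.norm_real, Real.norm_eq_abs]
    calc |f (M / N)| * N ≤ (1 / N * |deriv f 1| + K * (1 / (N : ℝ)) ^ 2) * N := by gcongr
      _ = |deriv f 1| + K * (1 / N) := by field_simp
      _ ≤ |deriv f 1| + K * 1 := by gcongr
      _ = B₁ := by rw [mul_one]
  -- the interior terms
  have hTaylor (l : ℕ) (hl : l < M) : ‖((f (((l + 2 : ℕ) : ℝ) / N) - f ((l : ℝ) / N) -
      2 / N * deriv f (((l + 1 : ℕ) : ℝ) / N) : ℝ) : ℂ)‖ ≤ 2 * K * (1 / (N : ℝ)) ^ 2 := by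
    have hp := norm_sub_sub_deriv_le hdiff hlip (hmem (l := l + 1) (by omega))
      (hmem (l := l + 2) (by omega))
    have hm := norm_sub_sub_deriv_le hdiff hlip (hmem (l := l + 1) (by omega))
      (hmem (l := l) (by omega))
    have ep : ((l + 2 : ℕ) : ℝ) / N - ((l + 1 : ℕ) : ℝ) / N = 1 / N := by
      push_cast
      ring
    have em : (l : ℝ) / N - ((l + 1 : ℕ) : ℝ) / N = -(1 / N) := by
      push_cast
      ring
    rw [ep, abs_of_pos (by positivity)] at hp
    rw [em, abs_neg, abs_of_pos (by positivity)] at hm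
    rw [Complex.norm_real]
    refine le_trans (le_of_eq ?_) ((norm_sub_le _ _).trans ((add_le_add hp hm).trans_eq (by ring)))
    congr 1
    ring
  have hTbound : ‖T‖ * N ^ 2 ≤ S * (2 * K) := by
    have hsumS : ∑ l ∈ Finset.range M, ‖phiHat α (k - ((l : ℤ) + 1))‖ ≤ S := by
      have hinj : Function.Injective fun l : ℕ => k - ((l : ℤ) + 1) := fun a b h => by
        simp only at h
        omega
      have h := hS.sum_le_tsum ((Finset.range M).map ⟨_, hinj⟩) fun _ _ => norm_nonneg _
      simpa using h
    calc ‖T‖ * N ^ 2 ≤ (∑ l ∈ Finset.range M, ‖phiHat α (k - ((l : ℤ) + 1))‖ *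
          (2 * K * (1 / (N : ℝ)) ^ 2)) * N ^ 2 := by
          gcongr
          refine norm_sum_le_of_le _ fun l hl => ?_
          rw [norm_mul]
          gcongr
          exact hTaylor l (Finset.mem_range.1 hl)
      _ = (∑ l ∈ Finset.range M, ‖phiHat α (k - ((l : ℤ) + 1))‖) * (2 * K) := by
          rw [← Finset.sum_mul]
          field_simp
      _ ≤ S * (2 * K) := by gcongr
  rw [hdecomp, norm_mul, Complex.norm_of_nonneg (by positivity), mul_comm]
  gcongr
  rw [norm_mul, norm_pow, Complex.norm_of_nonneg hNpos.le]
  calc (N : ℝ) ^ 2 * ‖phiHat α k * (f (1 / N) : ℂ) - phiHat α (k - N) * (f ((M : ℝ) / N) : ℂ) + T‖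
      ≤ (N : ℝ) ^ 2 * (‖phiHat α k‖ * ‖(f (1 / N) : ℂ)‖ +
          ‖phiHat α (k - N)‖ * ‖(f ((M : ℝ) / N) : ℂ)‖ + ‖T‖) := by
        gcongr
        refine (norm_add_le _ _).trans ?_
        gcongr
        refine (norm_sub_le _ _).trans_eq ?_
        rw [norm_mul, norm_mul]
    _ = (‖phiHat α k‖ * N) * (‖(f (1 / N) : ℂ)‖ * N) +
          (‖phiHat α (k - N)‖ * N) * (‖(f ((M : ℝ) / N) : ℂ)‖ * N) + ‖T‖ * N ^ 2 := by ring
    _ ≤ A / x * B₀ + A / (1 - x) * B₁ + S * (2 * K) := by gcongr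

/-- Let `α ∈ (0,1)`, `f` differentiable with `f(0) = f(1) = 0` and `f'` Lipschitz on `[0,1]`.
Then for `x ∈ (0,1)`, `D_{α+1}(f)(x)` exists iff `D_α(f')(x)` exists, and
`D_{α+1}(f)(x) = 2 D_α(f')(x)`. -/
theorem fractional_derivative_step (α : ℝ) (hα : α ∈ Set.Ioo (0 : ℝ) 1) (f : ℝ → ℝ)
    (hdiff : Differentiable ℝ f) (h0 : f 0 = 0) (h1 : f 1 = 0)
    (hlip : ∃ K : NNReal, LipschitzOnWith K (deriv f) (Set.Icc (0 : ℝ) 1))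
    (x : ℝ) (hx : x ∈ Set.Ioo (0 : ℝ) 1) :
    ((∃ L : ℂ, HasDAt (α + 1) f x L) ↔ (∃ L : ℂ, HasDAt α (deriv f) x L)) ∧
    (∀ L : ℂ, HasDAt α (deriv f) x L → HasDAt (α + 1) f x (2 * L)) := by
  obtain ⟨K, hK⟩ := hlip
  obtain ⟨C, hC⟩ := exists_norm_sum_sub_le hα hdiff h0 h1 hK hx
  have hpow : Tendsto (fun N : ℕ => C * (N : ℝ) ^ (α - 1)) atTop (nhds 0) := by
    have h := (tendsto_rpow_neg_atTop (sub_pos.2 hα.2)).comp tendsto_natCast_atTop_atTop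
    simpa [Function.comp_def] using h.const_mul C
  have hlim := squeeze_zero_norm' ((eventually_ne_atTop 0).mono hC) hpow
  have hstep (L : ℂ) (hL : HasDAt α (deriv f) x L) : HasDAt (α + 1) f x (2 * L) := by
    have h := hlim.add (Tendsto.const_mul 2 hL)
    simp only [sub_add_cancel, zero_add] at h
    exact h
  refine ⟨⟨fun ⟨L, hL⟩ => ⟨L / 2, ?_⟩, fun ⟨L, hL⟩ => ⟨2 * L, hstep L hL⟩⟩, hstep⟩
  have h := (Tendsto.sub hL hlim).div_const 2
  simp only [sub_sub_cancel, sub_zero, mul_div_cancel_left₀ _ (two_ne_zero' ℂ)] at h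
  exact h
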